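/- Single-edge determinant ratio monotonicity for subgraphs: Let G = (V, E) be a finite connected graph and G′ = (V′, E′) a connected subgraph of G (V′ ⊆ V, E′ ⊆ E). Fix vertices v₀ ∈ V and v₀′ ∈ V′, and write D_G(κ) = det L_G(κ)[V∖{v₀}] for κ ∈ (0,∞)^E and D_{G′}(κ′) = det L_{G′}(κ′)[V′∖{v₀′}] for κ′ ∈ (0,∞)^{E′}. Then for every edge f ∈ E′, every κ ∈ (0,∞)^E, and all 0 < c_f^− < c_f^+: D_{G′}((κ_f^+)↾E′) · D_G(κ_f^−) ≥ D_G(κ_f^+) · D_{G′}((κ_f^−)↾E′). In ratio form, D_{G′}(κ^+↾E′)/D_{G′}(κ^−↾E′) ≥ D_G(κ^+)/D_G(κ^−). -/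

import Mathlib

open scoped Classical

/-- The weighted graph Laplacian of a finite graph `G` with conductances
`κ : Sym2 α → ℝ`. -/
noncomputable def glap {α : Type*} [Fintype α] (G : SimpleGraph α) (κ : Sym2 α → ℝ) :
    Matrix α α ℝ :=
  Matrix.of fun x y =>
    if x = y then ∑ z : α, (if G.Adj x z then κ s(x, z) else 0)
    else if G.Adj x y then -κ s(x, y) else 0

/-- The reduced determinant `det L(κ)[α∖W]`. -/
noncomputable def gdet {α : Type*} [Fintype α] (G : SimpleGraph α) (κ : Sym2 α → ℝ)
    (W : Set α) : ℝ :=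
  ((glap G κ).submatrix (fun x : {x : α // x ∉ W} => (x : α))
    (fun x : {x : α // x ∉ W} => (x : α))).det

/-- Restriction of conductances `κ : Sym2 V → ℝ` to the vertex set of a subgraph. -/
noncomputable def restrictCond {V : Type*} {G : SimpleGraph V} (H : G.Subgraph)
    (κ : Sym2 V → ℝ) : Sym2 H.verts → ℝ :=
  fun e => κ (Sym2.map Subtype.val e)

/-- The Dirichlet energy of `u`, each edge being counted once per orientation. -/
noncomputable def dirichletEnergy {α : Type*} [Fintype α] (G : SimpleGraph α)
    (κ : Sym2 α → ℝ) (u : α → ℝ) : ℝ :=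
  ∑ x, ∑ z, if G.Adj x z then κ s(x, z) * (u x - u z) ^ 2 else 0

lemma dirichletEnergy_term_nonneg {α : Type*} {G : SimpleGraph α} {κ : Sym2 α → ℝ}
    (hκ : ∀ e ∈ G.edgeSet, 0 < κ e) (u : α → ℝ) (x z : α) :
    0 ≤ if G.Adj x z then κ s(x, z) * (u x - u z) ^ 2 else 0 := by
  split_ifs with h
  · exact mul_nonneg (hκ _ h).le (sq_nonneg _)
  · exact le_rfl

section Laplacian

open Matrix

variable {α : Type*} [Fintype α] (G : SimpleGraph α) (κ : Sym2 α → ℝ)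

lemma glap_mulVec (u : α → ℝ) (x : α) :
    (glap G κ *ᵥ u) x = ∑ z, if G.Adj x z then κ s(x, z) * (u x - u z) else 0 := by
  have h : ∀ y, glap G κ x y * u y =
      (if y = x then (∑ z, if G.Adj x z then κ s(x, z) else 0) * u x else 0) -
        (if G.Adj x y then κ s(x, y) * u y else 0) := by
    intro y
    by_cases hxy : x = y
    · subst hxy
      simp [glap]
    · by_cases hadj : G.Adj x y <;> simp [glap, hxy, Ne.symm hxy, hadj]
  simp only [mulVec, dotProduct, h, Finset.sum_sub_distrib, Finset.sum_ite_eq',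
    Finset.mem_univ, if_true, Finset.sum_mul]
  rw [← Finset.sum_sub_distrib]
  refine Finset.sum_congr rfl fun z _ => ?_
  split_ifs <;> ring

lemma glap_transpose : (glap G κ)ᵀ = glap G κ := by
  ext x y
  by_cases hxy : x = y
  · subst hxy; rfl
  · simp [glap, hxy, Ne.symm hxy, G.adj_comm y x, Sym2.eq_swap (a := y)]

lemma dotProduct_glap_mulVec_sub (y w : α → ℝ) :
    (y - w) ⬝ᵥ glap G κ *ᵥ (y - w) =
      y ⬝ᵥ glap G κ *ᵥ y - 2 * (y ⬝ᵥ glap G κ *ᵥ w) + w ⬝ᵥ glap G κ *ᵥ w := by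
  have h : w ⬝ᵥ glap G κ *ᵥ y = y ⬝ᵥ glap G κ *ᵥ w := by
    rw [dotProduct_mulVec, ← mulVec_transpose, glap_transpose, dotProduct_comm]
  rw [mulVec_sub, sub_dotProduct, dotProduct_sub, dotProduct_sub, h]
  ring

lemma two_mul_dotProduct_glap_mulVec (u : α → ℝ) :
    2 * (u ⬝ᵥ glap G κ *ᵥ u) = dirichletEnergy G κ u := by
  have h1 : u ⬝ᵥ glap G κ *ᵥ u =
      ∑ x, ∑ z, if G.Adj x z then κ s(x, z) * (u x - u z) * u x else 0 := by
    simp only [dotProduct, glap_mulVec, Finset.mul_sum]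
    refine Finset.sum_congr rfl fun x _ => Finset.sum_congr rfl fun z _ => ?_
    split_ifs <;> ring
  have h2 : u ⬝ᵥ glap G κ *ᵥ u =
      ∑ x, ∑ z, if G.Adj x z then κ s(x, z) * (u z - u x) * u z else 0 := by
    rw [h1, Finset.sum_comm]
    refine Finset.sum_congr rfl fun x _ => Finset.sum_congr rfl fun z _ => ?_
    rw [G.adj_comm z x, Sym2.eq_swap (a := z)]
  rw [two_mul]
  nth_rewrite 1 [h1]
  rw [h2, dirichletEnergy, ← Finset.sum_add_distrib]
  refine Finset.sum_congr rfl fun x _ => ?_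
  rw [← Finset.sum_add_distrib]
  refine Finset.sum_congr rfl fun z _ => ?_
  split_ifs <;> ring

variable {G κ}

lemma dotProduct_glap_mulVec_nonneg (hκ : ∀ e ∈ G.edgeSet, 0 < κ e) (u : α → ℝ) :
    0 ≤ u ⬝ᵥ glap G κ *ᵥ u := by
  have h : 0 ≤ dirichletEnergy G κ u := Finset.sum_nonneg fun x _ =>
    Finset.sum_nonneg fun z _ => dirichletEnergy_term_nonneg hκ u x z
  linarith [two_mul_dotProduct_glap_mulVec G κ u]

lemma eq_of_dotProduct_glap_mulVec_eq_zero (hG : G.Connected)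
    (hκ : ∀ e ∈ G.edgeSet, 0 < κ e) {u : α → ℝ} (hu : u ⬝ᵥ glap G κ *ᵥ u = 0) (x y : α) :
    u x = u y := by
  have hE : dirichletEnergy G κ u = 0 := by
    rw [← two_mul_dotProduct_glap_mulVec, hu, mul_zero]
  have hadj : ∀ x z, G.Adj x z → u x = u z := by
    intro x z hxz
    have h1 := (Finset.sum_eq_zero_iff_of_nonneg fun x _ => Finset.sum_nonneg fun z _ =>
      dirichletEnergy_term_nonneg hκ u x z).1 hE x (Finset.mem_univ x)
    have h2 := (Finset.sum_eq_zero_iff_of_nonneg fun z _ =>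
      dirichletEnergy_term_nonneg hκ u x z).1 h1 z (Finset.mem_univ z)
    rw [if_pos hxz] at h2
    have h3 := (mul_eq_zero.1 h2).resolve_left (hκ _ hxz).ne'
    exact sub_eq_zero.1 (pow_eq_zero_iff two_ne_zero |>.1 h3)
  obtain ⟨w⟩ := hG.preconnected x y
  induction w with
  | nil => rfl
  | cons h _ ih => exact (hadj _ _ h).trans ih

lemma glap_posSemidef (hκ : ∀ e ∈ G.edgeSet, 0 < κ e) : (glap G κ).PosSemidef := by
  refine PosSemidef.of_dotProduct_mulVec_nonneg ?_ fun u => ?_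
  · rw [IsHermitian, conjTranspose_eq_transpose_of_trivial, glap_transpose]
  · simpa using dotProduct_glap_mulVec_nonneg hκ u

lemma gdet_nonneg (hκ : ∀ e ∈ G.edgeSet, 0 < κ e) (W : Set α) : 0 ≤ gdet G κ W :=
  ((glap_posSemidef hκ).submatrix _).det_nonneg

lemma gdet_singleton (v : α) :
    gdet G κ {v} = ((glap G κ).updateRow v (Pi.single v 1)).det := by
  rw [twoBlockTriangular_det _ (fun x => x ∉ ({v} : Set α))]
  · have h1 : toSquareBlockProp ((glap G κ).updateRow v (Pi.single v 1))
        (fun x => ¬ x ∉ ({v} : Set α)) = 1 := by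
      ext ⟨x, hx⟩ ⟨y, hy⟩
      simp only [Set.mem_singleton_iff, not_not] at hx hy
      subst hx; subst hy
      simp [toSquareBlockProp]
    have h2 : toSquareBlockProp ((glap G κ).updateRow v (Pi.single v 1))
        (fun x => x ∉ ({v} : Set α)) =
        (glap G κ).submatrix (fun x : {x : α // x ∉ ({v} : Set α)} => (x : α))
          (fun x : {x : α // x ∉ ({v} : Set α)} => (x : α)) := by
      ext ⟨x, hx⟩ ⟨y, hy⟩
      simp only [Set.mem_singleton_iff] at hx
      simp [toSquareBlockProp, updateRow_apply, hx]
    rw [h1, h2, det_one, mul_one]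
    unfold gdet
    congr!
  · intro i hi j hj
    simp only [Set.mem_singleton_iff, not_not] at hi hj
    subst hi
    simp [hj]

lemma glap_det_eq_zero [Nonempty α] : (glap G κ).det = 0 := by
  refine exists_mulVec_eq_zero_iff.1 ⟨fun _ => 1, ?_, ?_⟩
  · exact fun h => one_ne_zero (congrFun h (Classical.arbitrary α))
  · ext x
    simp [glap_mulVec]

lemma gdet_singleton_eq (hG : G.Connected) (hκ : ∀ e ∈ G.edgeSet, 0 < κ e) (v w : α) :
    gdet G κ {v} = gdet G κ {w} := by
  have := hG.nonempty
  have hcol : ∀ x y z, (glap G κ).adjugate x z = (glap G κ).adjugate y z := by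
    intro x y z
    refine eq_of_dotProduct_glap_mulVec_eq_zero hG hκ
      (u := fun i => (glap G κ).adjugate i z) ?_ x y
    have h : glap G κ *ᵥ (fun i => (glap G κ).adjugate i z) = 0 := by
      have h0 : glap G κ * (glap G κ).adjugate = 0 := by
        rw [mul_adjugate, glap_det_eq_zero, zero_smul]
      ext i
      exact congrFun (congrFun h0 i) z
    rw [h, dotProduct_zero]
  have hsymm : (glap G κ).adjugate w v = (glap G κ).adjugate v w := by
    conv_rhs => rw [← glap_transpose, ← adjugate_transpose]
    rfl
  rw [gdet_singleton, gdet_singleton, ← adjugate_apply, ← adjugate_apply, hcol v w v, hsymm,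
    hcol v w w]

lemma dotProduct_eq_of_grounded {b : α} {y M : α → ℝ} {a : α} (hy : y b = 0)
    (hM : ∀ x, x ≠ b → M x = (Pi.single a 1 : α → ℝ) x) : y ⬝ᵥ M = y a := by
  have h : ∀ x, y x * M x = y x * (Pi.single a 1 : α → ℝ) x := by
    intro x
    by_cases hx : x = b
    · rw [hx, hy, zero_mul, zero_mul]
    · rw [hM x hx]
  simp [dotProduct, h, Pi.single_apply]

/-- The grounded potential of a unit current from `a` to `b`; its value at `a` is the effective
resistance, which governs how the reduced determinant depends on the conductance of `s(a, b)`. -/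
lemma exists_potential [DecidableEq (Sym2 α)] (hG : G.Connected) {a b : α} (hab : G.Adj a b) {c : ℝ}
    (hκ : ∀ e ∈ G.edgeSet, 0 < Function.update κ s(a, b) c e) :
    ∃ u : α → ℝ, u b = 0 ∧
      (∀ x, x ≠ b → (glap G (Function.update κ s(a, b) c) *ᵥ u) x =
        (Pi.single a 1 : α → ℝ) x) ∧
      ∀ c', gdet G (Function.update κ s(a, b) c') {b} =
        gdet G (Function.update κ s(a, b) c) {b} * (1 + (c' - c) * u a) := by
  set L := glap G (Function.update κ s(a, b) c) with hL
  set N := L.updateRow b (Pi.single b 1) with hN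
  have hNb : ∀ u : α → ℝ, (N *ᵥ u) b = u b := by
    intro u
    simp [hN, mulVec]
  have hNx : ∀ (u : α → ℝ) (x), x ≠ b → (N *ᵥ u) x = (L *ᵥ u) x := by
    intro u x hx
    simp [hN, mulVec, hx]
  have hdet : N.det ≠ 0 := by
    intro h0
    obtain ⟨u, hu0, hu⟩ := exists_mulVec_eq_zero_iff.2 h0
    have hub : u b = 0 := by rw [← hNb u, hu]; rfl
    have hE : u ⬝ᵥ L *ᵥ u = 0 := by
      refine Finset.sum_eq_zero fun x _ => ?_
      by_cases hx : x = b
      · rw [hx, hub, zero_mul]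
      · rw [← hNx u x hx, hu, Pi.zero_apply, mul_zero]
    exact hu0 (funext fun x => (eq_of_dotProduct_glap_mulVec_eq_zero hG hκ hE x b).trans hub)
  have hunit : IsUnit N.det := hdet.isUnit
  set u := N⁻¹ *ᵥ (Pi.single a 1 : α → ℝ) with hu
  have hNu : N *ᵥ u = Pi.single a 1 := by
    rw [hu, mulVec_mulVec, mul_nonsing_inv _ hunit, one_mulVec]
  have hub : u b = 0 := by rw [← hNb u, hNu]; simp [hab.ne']
  refine ⟨u, hub, fun x hx => by rw [← hNx u x hx, hNu], fun c' => ?_⟩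
  have hrank : (glap G (Function.update κ s(a, b) c')).updateRow b (Pi.single b 1) =
      N * (1 + vecMulVec u ((c' - c) • (Pi.single a 1 - Pi.single b 1 : α → ℝ))) := by
    rw [mul_add, mul_one, mul_vecMulVec, hNu]
    ext x y
    by_cases hx : x = b
    · subst hx
      simp [hN, vecMulVec_apply, hab.ne']
    · by_cases hxa : x = a
      · subst hxa
        by_cases hxy : x = y
        · subst hxy
          have hs : ∀ z, (if G.Adj x z then Function.update κ s(x, b) c' s(x, z) else 0) =
              (if G.Adj x z then Function.update κ s(x, b) c s(x, z) else 0) +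
                if z = b then c' - c else 0 := by
            intro z
            by_cases hz : z = b
            · subst hz
              simp [hab]
            · have : s(x, z) ≠ s(x, b) := fun h => hz (Sym2.congr_right.1 h)
              simp [hz, Function.update_of_ne this]
          simp [hN, hL, updateRow_apply, glap, hx, hs, Finset.sum_add_distrib,
            vecMulVec_apply]
        · by_cases hyb : y = b
          · subst hyb
            simp [hN, hL, updateRow_apply, glap, hx, hab, vecMulVec_apply, Ne.symm hx]
            ring
          · simp [hN, hL, updateRow_apply, glap, hx, hxy,
              vecMulVec_apply, hyb, Ne.symm hxy]
      · simp [hN, hL, updateRow_apply, glap, hx, hxa, vecMulVec_apply]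
  rw [gdet_singleton, gdet_singleton, hrank, det_mul, vecMulVec_eq Unit,
    det_one_add_replicateCol_mul_replicateRow]
  simp [sub_dotProduct, hub]
  exact Or.inl rfl

end Laplacian

lemma sum_subtype_le_sum {α : Type*} [Fintype α] (s : Set α) [Fintype s] {g : α → ℝ}
    (hg : ∀ x, 0 ≤ g x) : ∑ x : s, g x ≤ ∑ x, g x := by
  have h := Finset.sum_map Finset.univ (Function.Embedding.subtype (· ∈ s)) g
  simp only [Function.Embedding.subtype_apply] at h
  refine h.symm.trans_le ?_
  exact Finset.sum_le_sum_of_subset_of_nonneg (Finset.subset_univ _) fun x _ _ => hg x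

lemma dirichletEnergy_coe_le {V : Type*} [Fintype V] {G : SimpleGraph V} (H : G.Subgraph)
    [Fintype H.verts] {κ : Sym2 V → ℝ} (hκ : ∀ e ∈ G.edgeSet, 0 < κ e) (u : V → ℝ) :
    dirichletEnergy H.coe (restrictCond H κ) (fun x => u x) ≤ dirichletEnergy G κ u := by
  have hterm := dirichletEnergy_term_nonneg hκ u
  refine le_trans (Finset.sum_le_sum fun x _ => ?_)
    (sum_subtype_le_sum H.verts fun x => Finset.sum_nonneg fun z _ => hterm x z)
  refine le_trans (Finset.sum_le_sum fun z _ => ?_)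
    (sum_subtype_le_sum H.verts fun z => hterm x z)
  by_cases h : H.Adj x z
  · simp [restrictCond, h, H.adj_sub h]
  · simpa [h] using hterm x z

lemma restrictCond_update {V : Type*} {G : SimpleGraph V} (H : G.Subgraph) (κ : Sym2 V → ℝ)
    (a b : H.verts) (c : ℝ) :
    restrictCond H (Function.update κ s((a : V), (b : V)) c) =
      Function.update (restrictCond H κ) s(a, b) c := by
  have h : s((a : V), (b : V)) = Sym2.map Subtype.val s(a, b) := rfl
  funext e
  rw [restrictCond, h]
  exact Function.update_apply_of_injective _ (Sym2.map.injective Subtype.val_injective) _ _ _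

/-- **Single-edge determinant ratio monotonicity for subgraphs**:
for a connected subgraph `G' = (V', E')` of `G` and an edge `f ∈ E'`,
`D_{G′}(κ⁺↾E′) · D_G(κ⁻) ≥ D_G(κ⁺) · D_{G′}(κ⁻↾E′)`. -/
theorem subgraph_det_ratio_mono
    {V : Type*} [Fintype V] (G : SimpleGraph V) (hconn : G.Connected)
    (H : G.Subgraph) (hHconn : H.Connected)
    (v₀ : V) (v₀' : H.verts)
    (f : Sym2 V) (hf : f ∈ H.edgeSet)
    (cm cp : ℝ) (hc0 : 0 < cm) (hc : cm < cp)
    (κ : Sym2 V → ℝ) (hκpos : ∀ e ∈ G.edgeSet, 0 < κ e) :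
    gdet G (Function.update κ f cp) {v₀} *
        gdet H.coe (restrictCond H (Function.update κ f cm)) {v₀'}
      ≤ gdet H.coe (restrictCond H (Function.update κ f cp)) {v₀'} *
          gdet G (Function.update κ f cm) {v₀} := by
  induction f with | _ a b
  have hH : H.Adj a b := hf
  have hG : G.Adj a b := H.adj_sub hH
  let a' : H.verts := ⟨a, H.edge_vert hH⟩
  let b' : H.verts := ⟨b, H.edge_vert hH.symm⟩
  have hH' : H.coe.Adj a' b' := hH
  have hpos : ∀ c, 0 < c → ∀ e ∈ G.edgeSet, 0 < Function.update κ s(a, b) c e := by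
    intro c hc e he
    rw [Function.update_apply]
    split_ifs
    · exact hc
    · exact hκpos e he
  have hres : ∀ c, restrictCond H (Function.update κ s(a, b) c) =
      Function.update (restrictCond H κ) s(a', b') c := restrictCond_update H κ a' b'
  have hposH : ∀ c, 0 < c → ∀ e ∈ H.coe.edgeSet,
      0 < Function.update (restrictCond H κ) s(a', b') c e := by
    intro c hc e he
    rw [← hres]
    refine hpos c hc _ ?_
    induction e with | _ x y
    exact H.adj_sub he
  have hcp : 0 < cp := hc0.trans hc
  obtain ⟨u, hub, hu, hdet⟩ := exists_potential hconn hG (hpos cm hc0)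
  obtain ⟨w, hwb, hw, hdetH⟩ := exists_potential hHconn.coe hH' (hposH cm hc0)
  have hEu := dotProduct_eq_of_grounded hub hu
  have hEw := dotProduct_eq_of_grounded hwb hw
  let y : H.verts → ℝ := fun x => u x
  have hEyw := dotProduct_eq_of_grounded (y := y) hub hw
  have hle := dirichletEnergy_coe_le H (hpos cm hc0) u
  rw [← two_mul_dotProduct_glap_mulVec, ← two_mul_dotProduct_glap_mulVec, hEu, hres] at hle
  have hnn := dotProduct_glap_mulVec_nonneg (hposH cm hc0) (y - w)
  rw [dotProduct_glap_mulVec_sub, hEyw, hEw] at hnn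
  have huw : u a ≤ w a' := by
    have : y a' = u a := rfl
    linarith
  rw [hres, hres, gdet_singleton_eq hconn (hpos cp hcp) v₀ b,
    gdet_singleton_eq hconn (hpos cm hc0) v₀ b,
    gdet_singleton_eq hHconn.coe (hposH cp hcp) v₀' b',
    gdet_singleton_eq hHconn.coe (hposH cm hc0) v₀' b', hdet cp, hdetH cp]
  have h1 := mul_nonneg (gdet_nonneg (hpos cm hc0) {b}) (gdet_nonneg (hposH cm hc0) {b'})
  have h2 := mul_nonneg h1 (mul_nonneg (sub_nonneg.2 hc.le) (sub_nonneg.2 huw))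
  linarith
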